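/- Fix c ∈ ℝ and define the parabolic catenoid X : ℝ² → M₂(ℂ) by X(u,v) = e^{cv}·[[u² + v², u + iv],[u − iv, 1]]. Then: (i) X(u,v) is Hermitian with det X(u,v) = 0 and tr X(u,v) > 0 for all (u,v), so X maps into ℚ³₊; (ii) X is conformal: ⟨X_u, X_u⟩ = ⟨X_v, X_v⟩ = e^{2cv} > 0 and ⟨X_u, X_v⟩ = 0; (iii) X is invariant under the parabolic rotations R^P(t) = [[1, t],[0, 1]]: X(u+t, v) = R^P(t)·X(u,v)·R^P(t)⋆ for all t; and (iv) X has zero mean curvature: there exists a smooth map n : ℝ² → Herm(2,ℂ) with ⟨n,n⟩ = ⟨n, X_u⟩ = ⟨n, X_v⟩ = 0, ⟨n, X⟩ = 1, and ⟨X_u, n_u⟩ + ⟨X_v, n_v⟩ = 0 at every point. -/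

import Mathlib

open Matrix
open scoped ComplexOrder

/-- The Lorentz inner product on 2×2 complex matrices, via determinant polarization. -/
noncomputable def ip (V W : Matrix (Fin 2) (Fin 2) ℂ) : ℂ :=
  -(1 / 2) * ((V + W).det - V.det - W.det)

/-- The parabolic catenoid. -/
noncomputable def XP (c : ℝ) (u v : ℝ) : Matrix (Fin 2) (Fin 2) ℂ :=
  Complex.exp ((c : ℂ) * v) •
    !![(u : ℂ) ^ 2 + (v : ℂ) ^ 2, (u : ℂ) + (v : ℂ) * Complex.I;
       (u : ℂ) - (v : ℂ) * Complex.I, 1]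

/-- Its partial derivative in u. -/
noncomputable def XPu (c : ℝ) (u v : ℝ) : Matrix (Fin 2) (Fin 2) ℂ :=
  Complex.exp ((c : ℂ) * v) • !![2 * (u : ℂ), 1; 1, 0]

/-- Its partial derivative in v. -/
noncomputable def XPv (c : ℝ) (u v : ℝ) : Matrix (Fin 2) (Fin 2) ℂ :=
  ((c : ℂ) * Complex.exp ((c : ℂ) * v)) •
    !![(u : ℂ) ^ 2 + (v : ℂ) ^ 2, (u : ℂ) + (v : ℂ) * Complex.I;
       (u : ℂ) - (v : ℂ) * Complex.I, 1] +
  Complex.exp ((c : ℂ) * v) • !![2 * (v : ℂ), Complex.I; -Complex.I, 0]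

/-- The parabolic rotation R^P(t) = [[1, t],[0, 1]]. -/
noncomputable def RP (t : ℝ) : Matrix (Fin 2) (Fin 2) ℂ :=
  !![1, (t : ℂ); 0, 1]

noncomputable def NP (c : ℝ) (u v : ℝ) : Matrix (Fin 2) (Fin 2) ℂ :=
  Complex.exp (-(c : ℂ) * v) •
    !![-2 - 2 * (c : ℂ) * v - (c : ℂ) ^ 2 / 2 * ((u : ℂ) ^ 2 + (v : ℂ) ^ 2),
       -(c : ℂ) * Complex.I - (c : ℂ) ^ 2 / 2 * ((u : ℂ) + (v : ℂ) * Complex.I);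
       (c : ℂ) * Complex.I - (c : ℂ) ^ 2 / 2 * ((u : ℂ) - (v : ℂ) * Complex.I),
       -(c : ℂ) ^ 2 / 2]

noncomputable def NPu (c : ℝ) (u v : ℝ) : Matrix (Fin 2) (Fin 2) ℂ :=
  Complex.exp (-(c : ℂ) * v) •
    !![- (c : ℂ) ^ 2 / 2 * (2 * (u : ℂ)), -(c : ℂ) ^ 2 / 2; -(c : ℂ) ^ 2 / 2, 0]

noncomputable def NPv (c : ℝ) (u v : ℝ) : Matrix (Fin 2) (Fin 2) ℂ :=
  (-(c : ℂ)) • NP c u v + Complex.exp (-(c : ℂ) * v) •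
    !![-2 * (c : ℂ) - (c : ℂ) ^ 2 / 2 * (2 * (v : ℂ)), -(c : ℂ) ^ 2 / 2 * Complex.I;
       (c : ℂ) ^ 2 / 2 * Complex.I, 0]

/-- A quadratic polynomial with complex coefficients in a real variable. -/
lemma hd_quad (a b d : ℂ) (x : ℝ) :
    HasDerivAt (fun y : ℝ => a + b * (y : ℂ) + d * (y : ℂ) ^ 2) (b + d * (2 * (x : ℂ))) x := by
  have h : HasDerivAt (fun y : ℝ => (y : ℂ)) 1 x := (hasDerivAt_id x).ofReal_comp
  have h2 := ((h.const_mul b).const_add a).add ((h.pow 2).const_mul d)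
  refine h2.congr_deriv ?_
  push_cast
  ring

lemma hd_exp (k a b d : ℂ) (x : ℝ) :
    HasDerivAt (fun y : ℝ => Complex.exp (k * (y : ℂ)) * (a + b * (y : ℂ) + d * (y : ℂ) ^ 2))
      (k * Complex.exp (k * (x : ℂ)) * (a + b * (x : ℂ) + d * (x : ℂ) ^ 2) +
        Complex.exp (k * (x : ℂ)) * (b + d * (2 * (x : ℂ)))) x := by
  have h : HasDerivAt (fun y : ℝ => (y : ℂ)) 1 x := (hasDerivAt_id x).ofReal_comp
  have h2 := (h.const_mul k).cexp.mul (hd_quad a b d x)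
  refine h2.congr_deriv ?_
  ring

lemma hd_of_quad (f : ℝ → ℂ) (f' : ℂ) (k a b d : ℂ) (x : ℝ)
    (hf : ∀ y : ℝ, f y = k * (a + b * (y : ℂ) + d * (y : ℂ) ^ 2))
    (hf' : f' = k * (b + d * (2 * (x : ℂ)))) : HasDerivAt f f' x := by
  rw [hf', funext hf]
  exact (hd_quad a b d x).const_mul k

lemma hd_of_exp (f : ℝ → ℂ) (f' : ℂ) (k a b d : ℂ) (x : ℝ)
    (hf : ∀ y : ℝ, f y = Complex.exp (k * (y : ℂ)) * (a + b * (y : ℂ) + d * (y : ℂ) ^ 2))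
    (hf' : f' = k * Complex.exp (k * (x : ℂ)) * (a + b * (x : ℂ) + d * (x : ℂ) ^ 2) +
        Complex.exp (k * (x : ℂ)) * (b + d * (2 * (x : ℂ)))) : HasDerivAt f f' x := by
  rw [hf', funext hf]
  exact hd_exp k a b d x

lemma ip_eq (V W : Matrix (Fin 2) (Fin 2) ℂ) :
    ip V W = -(1 / 2) * (V 0 0 * W 1 1 + V 1 1 * W 0 0 - V 0 1 * W 1 0 - V 1 0 * W 0 1) := by
  simp only [ip, Matrix.det_fin_two, Matrix.add_apply]
  ring

lemma conj_exp_real (a b : ℝ) :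
    (starRingEnd ℂ) (Complex.exp ((a : ℂ) * b)) = Complex.exp ((a : ℂ) * b) := by
  rw [← Complex.exp_conj]; simp

theorem parabolic_catenoid (c : ℝ) :
    -- (o) XPu, XPv are indeed the partial derivatives of XP
    (∀ u v : ℝ, ∀ i j : Fin 2,
      HasDerivAt (fun u' => XP c u' v i j) (XPu c u v i j) u ∧
      HasDerivAt (fun v' => XP c u v' i j) (XPv c u v i j) v) ∧
    -- (i) X maps into the light cone ℚ³₊
    (∀ u v : ℝ, (XP c u v).IsHermitian ∧ (XP c u v).det = 0 ∧ 0 < (XP c u v).trace) ∧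
    -- (ii) conformality
    (∀ u v : ℝ,
      ip (XPu c u v) (XPu c u v) = ((Real.exp (2 * c * v) : ℝ) : ℂ) ∧
      ip (XPv c u v) (XPv c u v) = ((Real.exp (2 * c * v) : ℝ) : ℂ) ∧
      (0 : ℝ) < Real.exp (2 * c * v) ∧
      ip (XPu c u v) (XPv c u v) = 0) ∧
    -- (iii) rotational invariance
    (∀ u v t : ℝ, XP c (u + t) v = RP t * XP c u v * (RP t)ᴴ) ∧
    -- (iv) zero mean curvature via the Gauss map
    (∃ n nu nv : ℝ → ℝ → Matrix (Fin 2) (Fin 2) ℂ,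
      (∀ i j : Fin 2, ContDiff ℝ (⊤ : ℕ∞) (fun p : ℝ × ℝ => n p.1 p.2 i j)) ∧
      (∀ u v : ℝ, ∀ i j : Fin 2,
        HasDerivAt (fun u' => n u' v i j) (nu u v i j) u ∧
        HasDerivAt (fun v' => n u v' i j) (nv u v i j) v) ∧
      (∀ u v : ℝ,
        (n u v).IsHermitian ∧
        ip (n u v) (n u v) = 0 ∧ ip (n u v) (XPu c u v) = 0 ∧
        ip (n u v) (XPv c u v) = 0 ∧ ip (n u v) (XP c u v) = 1 ∧
        ip (XPu c u v) (nu u v) + ip (XPv c u v) (nv u v) = 0)) := by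
  have I2 : Complex.I ^ 2 = -1 := Complex.I_sq
  refine ⟨?_, ?_, ?_, ?_, NP c, NPu c, NPv c, ?_, ?_, ?_⟩
  · intro u v i j
    constructor
    · fin_cases i <;> fin_cases j
      · apply hd_of_quad _ _ (Complex.exp ((c : ℂ) * v)) ((v : ℂ) ^ 2) 0 1 <;> intros <;>
          simp [XP, XPu] <;> ring
      · apply hd_of_quad _ _ (Complex.exp ((c : ℂ) * v)) ((v : ℂ) * Complex.I) 1 0 <;> intros <;>
          simp [XP, XPu] <;> ring
      · apply hd_of_quad _ _ (Complex.exp ((c : ℂ) * v)) (-(v : ℂ) * Complex.I) 1 0 <;> intros <;>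
          simp [XP, XPu] <;> ring
      · apply hd_of_quad _ _ (Complex.exp ((c : ℂ) * v)) 1 0 0 <;> intros <;>
          simp [XP, XPu]
    · fin_cases i <;> fin_cases j
      · apply hd_of_exp _ _ (c : ℂ) ((u : ℂ) ^ 2) 0 1 <;> intros <;>
          simp [XP, XPv]
      · apply hd_of_exp _ _ (c : ℂ) (u : ℂ) Complex.I 0 <;> intros <;>
          simp [XP, XPv] <;> ring_nf <;> simp
      · apply hd_of_exp _ _ (c : ℂ) (u : ℂ) (-Complex.I) 0 <;> intros <;>
          simp [XP, XPv] <;> ring_nf <;> simp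
      · apply hd_of_exp _ _ (c : ℂ) 1 0 0 <;> intros <;>
          simp [XP, XPv]
  · intro u v
    refine ⟨?_, ?_, ?_⟩
    · ext i j
      have := conj_exp_real c v
      fin_cases i <;> fin_cases j <;> simp [XP, this] <;> ring
    · simp only [XP, Matrix.det_smul, Matrix.det_fin_two_of, Fintype.card_fin]
      linear_combination Complex.exp ((c : ℂ) * v) ^ 2 * (v : ℂ) ^ 2 * I2
    · have : (XP c u v).trace = ((Real.exp (c * v) * (u ^ 2 + v ^ 2 + 1) : ℝ) : ℂ) := by
        simp [XP, Matrix.trace_fin_two]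
        ring
      rw [this, Complex.zero_lt_real]
      positivity
  · intro u v
    have hE : ((Real.exp (2 * c * v) : ℝ) : ℂ) = Complex.exp ((c : ℂ) * v) ^ 2 := by
      rw [← Complex.exp_nat_mul]; push_cast; ring_nf
    refine ⟨?_, ?_, Real.exp_pos _, ?_⟩
    · rw [hE, ip_eq]
      simp [XPu]
      ring
    · rw [hE, ip_eq]
      simp [XPv]
      generalize Complex.exp ((c : ℂ) * v) = e
      linear_combination (-e ^ 2 - 2 * (c : ℂ) * v * e ^ 2 - e ^ 2 * (c : ℂ) ^ 2 * (v : ℂ) ^ 2) * I2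
    · rw [ip_eq]
      simp [XPu, XPv]
      ring
  · intro u v t
    ext i j
    fin_cases i <;> fin_cases j <;>
      simp [XP, RP, Matrix.mul_apply, Fin.sum_univ_two] <;> ring
  · intro i j
    have h1 : ContDiff ℝ (⊤ : ℕ∞) (fun p : ℝ × ℝ => (p.1 : ℂ)) :=
      Complex.ofRealCLM.contDiff.comp contDiff_fst
    have h2 : ContDiff ℝ (⊤ : ℕ∞) (fun p : ℝ × ℝ => (p.2 : ℂ)) :=
      Complex.ofRealCLM.contDiff.comp contDiff_snd
    have h3 : ContDiff ℝ (⊤ : ℕ∞) (fun p : ℝ × ℝ => Complex.exp (-(c : ℂ) * p.2)) :=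
      (contDiff_const.mul h2).cexp
    fin_cases i <;> fin_cases j <;>
      simp only [NP, Matrix.smul_apply, smul_eq_mul] <;> refine h3.mul ?_ <;> simp <;> fun_prop
  · intro u v i j
    constructor
    · fin_cases i <;> fin_cases j
      · apply hd_of_quad _ _ (Complex.exp (-(c : ℂ) * v))
          (-2 - 2 * (c : ℂ) * v - (c : ℂ) ^ 2 / 2 * (v : ℂ) ^ 2) 0 (-(c : ℂ) ^ 2 / 2) <;> intros <;>
          simp [NP, NPu] <;> ring
      · apply hd_of_quad _ _ (Complex.exp (-(c : ℂ) * v))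
          (-(c : ℂ) * Complex.I - (c : ℂ) ^ 2 / 2 * ((v : ℂ) * Complex.I)) (-(c : ℂ) ^ 2 / 2) 0 <;>
          intros <;> simp [NP, NPu] <;> ring
      · apply hd_of_quad _ _ (Complex.exp (-(c : ℂ) * v))
          ((c : ℂ) * Complex.I + (c : ℂ) ^ 2 / 2 * ((v : ℂ) * Complex.I)) (-(c : ℂ) ^ 2 / 2) 0 <;>
          intros <;> simp [NP, NPu] <;> ring
      · apply hd_of_quad _ _ (Complex.exp (-(c : ℂ) * v)) (-(c : ℂ) ^ 2 / 2) 0 0 <;> intros <;>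
          simp [NP, NPu]
    · fin_cases i <;> fin_cases j
      · apply hd_of_exp _ _ (-(c : ℂ)) (-2 - (c : ℂ) ^ 2 / 2 * (u : ℂ) ^ 2) (-2 * (c : ℂ))
          (-(c : ℂ) ^ 2 / 2) <;> intros <;> simp [NP, NPv] <;> ring
      · apply hd_of_exp _ _ (-(c : ℂ)) (-(c : ℂ) * Complex.I - (c : ℂ) ^ 2 / 2 * (u : ℂ))
          (-(c : ℂ) ^ 2 / 2 * Complex.I) 0 <;> intros <;> simp [NP, NPv] <;> ring
      · apply hd_of_exp _ _ (-(c : ℂ)) ((c : ℂ) * Complex.I - (c : ℂ) ^ 2 / 2 * (u : ℂ))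
          ((c : ℂ) ^ 2 / 2 * Complex.I) 0 <;> intros <;> simp [NP, NPv] <;> ring
      · apply hd_of_exp _ _ (-(c : ℂ)) (-(c : ℂ) ^ 2 / 2) 0 0 <;> intros <;>
          simp [NP, NPv] <;> ring
  · intro u v
    have hef : Complex.exp ((c : ℂ) * v) * Complex.exp (-((c : ℂ) * v)) = 1 := by
      rw [← Complex.exp_add]; simp
    refine ⟨?_, ?_, ?_, ?_, ?_, ?_⟩
    · ext i j
      have := conj_exp_real (-c) v
      push_cast at this
      rw [neg_mul] at this
      fin_cases i <;> fin_cases j <;> simp [NP, this] <;> ring_nf <;> simp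
    all_goals
      rw [ip_eq]
      try rw [ip_eq]
      simp [NP, NPu, NPv, XP, XPu, XPv]
      generalize Complex.exp ((c : ℂ) * v) = e at *
      generalize Complex.exp (-((c : ℂ) * v)) = f at *
      generalize (c : ℂ) = c at *
      generalize (u : ℂ) = u at *
      generalize (v : ℂ) = v at *
      generalize Complex.I = I at *
      grind
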